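/- arXiv:math/0504507 — 8 statements merged into one kernel-verified Lean document; each statement's English description precedes it below -/
import Mathlib

section
/- Let L ≥ 1 and let H_c : [0,1]^L → [0,1] be nondecreasing in each coordinate. Suppose that whenever U_1, …, U_L are independent random variables each uniformly distributed on [0,1], the random variable H_c(U_1, …, U_L) is uniformly distributed on [0,1]. Then for all (u_1, …, u_L) ∈ [0,1]^L one has H_c(u_1, …, u_L) ≥ ∏_{ℓ=1}^L u_ℓ and 1 − H_c(u_1, …, u_L) ≥ ∏_{ℓ=1}^L (1 − u_ℓ). -/
open MeasureTheory Set

/-- A function that is nondecreasing in each coordinate separately over a product of sets is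
monotone on this product. -/
theorem monotoneOn_pi_of_update {ι α β : Type*} [Fintype ι] [DecidableEq ι] [Preorder α]
    [Preorder β] {f : (ι → α) → β} {s : Set α}
    (h : ∀ (i : ι) (u : ι → α), (∀ j, u j ∈ s) → ∀ x ∈ s, ∀ y ∈ s, x ≤ y →
      f (Function.update u i x) ≤ f (Function.update u i y)) :
    MonotoneOn f (univ.pi fun _ => s) := by
  intro v hv w hw hvw
  have key : ∀ t : Finset ι, f v ≤ f (t.piecewise w v) := by
    intro t
    induction t using Finset.induction_on with
    | empty => simp
    | insert i t hi ih =>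
      rw [Finset.piecewise_insert]
      have hmem : ∀ j, t.piecewise w v j ∈ s := fun j => by
        by_cases hj : j ∈ t
        · simpa [hj] using hw j trivial
        · simpa [hj] using hv j trivial
      have hstep := h i (t.piecewise w v) hmem (v i) (hv i trivial) (w i) (hw i trivial) (hvw i)
      have hself : Function.update (t.piecewise w v) i (v i) = t.piecewise w v := by
        rw [Function.update_eq_self_iff, Finset.piecewise_eq_of_notMem _ _ _ hi]
      rw [hself] at hstep
      exact ih.trans hstep
  simpa using key Finset.univ

/-- The uniform measure on the unit cube of a box contained in the cube. -/
theorem pi_restrict_Icc_box {ι : Type*} [Fintype ι] {a b : ι → ℝ}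
    (ha : ∀ i, 0 ≤ a i) (hb : ∀ i, b i ≤ 1) (hab : ∀ i, a i ≤ b i) :
    (Measure.pi fun _ : ι => volume.restrict (Icc (0:ℝ) 1)) (univ.pi fun i => Icc (a i) (b i))
      = ENNReal.ofReal (∏ i, (b i - a i)) := by
  rw [Measure.pi_pi, ENNReal.ofReal_prod_of_nonneg fun i _ => sub_nonneg.2 (hab i)]
  refine Finset.prod_congr rfl fun i _ => ?_
  rw [Measure.restrict_apply measurableSet_Icc,
    inter_eq_left.2 (Icc_subset_Icc (ha i) (hb i)), Real.volume_Icc]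

/-- If `Hc` pushes the uniform measure on the unit cube to the uniform measure on `[0,1]` and maps
a box contained in the cube into `[c, d] ⊆ [0,1]`, then the box has volume at most `d - c`. -/
theorem prod_sub_le_of_map_uniform {ι : Type*} [Fintype ι] {Hc : (ι → ℝ) → ℝ}
    (hmeas : Measurable Hc)
    (hunif : Measure.map Hc (Measure.pi fun _ : ι => volume.restrict (Icc (0:ℝ) 1))
      = volume.restrict (Icc (0:ℝ) 1))
    {a b : ι → ℝ} (ha : ∀ i, 0 ≤ a i) (hb : ∀ i, b i ≤ 1) (hab : ∀ i, a i ≤ b i)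
    {c d : ℝ} (hcd : c ≤ d)
    (hbox : MapsTo Hc (univ.pi fun i => Icc (a i) (b i)) (Icc c d)) :
    ∏ i, (b i - a i) ≤ d - c := by
  rw [← ENNReal.ofReal_le_ofReal_iff (sub_nonneg.2 hcd), ← pi_restrict_Icc_box ha hb hab]
  calc _ ≤ (Measure.pi fun _ : ι => volume.restrict (Icc (0:ℝ) 1)) (Hc ⁻¹' Icc c d) :=
        measure_mono hbox
    _ = volume.restrict (Icc (0:ℝ) 1) (Icc c d) := by
        rw [← Measure.map_apply hmeas measurableSet_Icc, hunif]
    _ ≤ volume (Icc c d) := Measure.restrict_apply_le _ _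
    _ = ENNReal.ofReal (d - c) := Real.volume_Icc

/-- **Lemma A.1.** If `Hc : [0,1]^L → [0,1]` is nondecreasing in each coordinate and
`Hc (U₁, …, U_L)` is uniform on `[0,1]` whenever the `Uᵢ` are independent uniform-`[0,1]`
random variables, then `Hc u ≥ ∏ uᵢ` and `1 - Hc u ≥ ∏ (1 - uᵢ)` on the cube. -/
theorem combined_cd_tail_bounds
    (L : ℕ) (hL : 1 ≤ L) (Hc : (Fin L → ℝ) → ℝ)
    (hmeas : Measurable Hc)
    (hrange : ∀ u : Fin L → ℝ, (∀ i, u i ∈ Icc (0:ℝ) 1) → Hc u ∈ Icc (0:ℝ) 1)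
    (hmono : ∀ (i : Fin L) (u : Fin L → ℝ), (∀ j, u j ∈ Icc (0:ℝ) 1) →
      ∀ x ∈ Icc (0:ℝ) 1, ∀ y ∈ Icc (0:ℝ) 1, x ≤ y →
        Hc (Function.update u i x) ≤ Hc (Function.update u i y))
    (hunif : Measure.map Hc (Measure.pi fun _ : Fin L => volume.restrict (Icc (0:ℝ) 1))
      = volume.restrict (Icc (0:ℝ) 1)) :
    ∀ u : Fin L → ℝ, (∀ i, u i ∈ Icc (0:ℝ) 1) →
      (∏ i, u i) ≤ Hc u ∧ (∏ i, (1 - u i)) ≤ 1 - Hc u := by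
  intro u hu
  have hm := monotoneOn_pi_of_update hmono
  have hHu := hrange u hu
  have hu' : u ∈ univ.pi fun _ : Fin L => Icc (0:ℝ) 1 := fun i _ => hu i
  constructor
  · have h := prod_sub_le_of_map_uniform hmeas hunif (a := fun _ => 0) (b := u)
      (fun _ => le_rfl) (fun i => (hu i).2) (fun i => (hu i).1) hHu.1 fun v hv => by
        have hv' : ∀ i, v i ∈ Icc (0:ℝ) 1 := fun i =>
          ⟨(hv i trivial).1, (hv i trivial).2.trans (hu i).2⟩
        exact ⟨(hrange v hv').1, hm (fun i _ => hv' i) hu' fun i => (hv i trivial).2⟩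
    simpa using h
  · exact prod_sub_le_of_map_uniform hmeas hunif (a := u) (b := fun _ => 1)
      (fun i => (hu i).1) (fun _ => le_rfl) (fun i => (hu i).2) hHu.2 fun v hv => by
        have hv' : ∀ i, v i ∈ Icc (0:ℝ) 1 := fun i =>
          ⟨(hu i).1.trans (hv i trivial).1, (hv i trivial).2⟩
        exact ⟨hm hu' (fun i _ => hv' i) fun i => (hv i trivial).1, (hrange v hv').2⟩
end

section
/- Let L ≥ 1 and let H_c : [0,1]^L → [0,1] be nondecreasing in each coordinate, such that H_c(U_1, …, U_L) is uniformly distributed on [0,1] whenever U_1, …, U_L are independent uniform-[0,1] random variables. Let c_1, …, c_L ≥ 0 and, for each j = 1, …, L, let (a_{j,n})_{n≥1} be a sequence in (0,1) with −(1/n) log a_{j,n} → c_j as n → ∞. Then limsup_{n→∞} [−(1/n) log H_c(a_{1,n}, …, a_{L,n})] ≤ Σ_{j=1}^L c_j. Similarly, if d_1, …, d_L ≥ 0 and −(1/n) log(1 − a_{j,n}) → d_j for each j, then limsup_{n→∞} [−(1/n) log(1 − H_c(a_{1,n}, …, a_{L,n}))] ≤ Σ_{j=1}^L d_j. -/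
open MeasureTheory Set Filter

/-- A function that is nondecreasing in each coordinate separately on the unit cube is
nondecreasing there for the product order. -/
theorem apply_le_apply_of_update_le {ι : Type*} [Fintype ι] [DecidableEq ι] {f : (ι → ℝ) → ℝ}
    (hmono : ∀ (i : ι) (u : ι → ℝ), (∀ j, u j ∈ Icc (0:ℝ) 1) →
      ∀ x ∈ Icc (0:ℝ) 1, ∀ y ∈ Icc (0:ℝ) 1, x ≤ y →
        f (Function.update u i x) ≤ f (Function.update u i y))
    {u v : ι → ℝ} (hu : ∀ j, u j ∈ Icc (0:ℝ) 1) (hv : ∀ j, v j ∈ Icc (0:ℝ) 1) (huv : u ≤ v) :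
    f u ≤ f v := by
  have key : ∀ s : Finset ι, f u ≤ f (s.piecewise v u) := by
    intro s
    induction s using Finset.induction_on with
    | empty => simp
    | insert j s hj ih =>
      refine ih.trans ?_
      have hw : ∀ k, s.piecewise v u k ∈ Icc (0:ℝ) 1 := fun k => by
        by_cases hk : k ∈ s
        · rw [Finset.piecewise_eq_of_mem _ _ _ hk]; exact hv k
        · rw [Finset.piecewise_eq_of_notMem _ _ _ hk]; exact hu k
      have h := hmono j (s.piecewise v u) hw (u j) (hu j) (v j) (hv j) (huv j)
      rw [Finset.piecewise_insert]
      rwa [← Finset.piecewise_eq_of_notMem s v u hj, Function.update_eq_self] at h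
  simpa using key Finset.univ

/-- If `f` pushes the uniform law on the unit cube to the uniform law on `[0,1]` and maps a
sub-box into `[p, q]`, then the volume of the box is at most `q - p`. -/
theorem prod_sub_le_of_map_uniform_s1 {ι : Type*} [Fintype ι] {f : (ι → ℝ) → ℝ}
    (hmeas : Measurable f)
    (hunif : Measure.map f (Measure.pi fun _ : ι => volume.restrict (Icc (0:ℝ) 1))
      = volume.restrict (Icc (0:ℝ) 1))
    {l r : ι → ℝ} (hl : ∀ j, 0 ≤ l j) (hlr : ∀ j, l j ≤ r j) (hr : ∀ j, r j ≤ 1)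
    {p q : ℝ} (hpq : p ≤ q) (hf : ∀ u, (∀ j, u j ∈ Icc (l j) (r j)) → f u ∈ Icc p q) :
    ∏ j, (r j - l j) ≤ q - p := by
  have hbox : (Measure.pi fun _ : ι => volume.restrict (Icc (0:ℝ) 1))
      (Set.pi univ fun j => Icc (l j) (r j)) = ENNReal.ofReal (∏ j, (r j - l j)) := by
    rw [Measure.pi_pi, ENNReal.ofReal_prod_of_nonneg fun j _ => sub_nonneg.2 (hlr j)]
    refine Finset.prod_congr rfl fun j _ => ?_
    rw [Measure.restrict_apply measurableSet_Icc,
      inter_eq_self_of_subset_left (Icc_subset_Icc (hl j) (hr j)), Real.volume_Icc]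
  refine (ENNReal.ofReal_le_ofReal_iff (sub_nonneg.2 hpq)).1 ?_
  calc ENNReal.ofReal (∏ j, (r j - l j))
      ≤ (Measure.pi fun _ : ι => volume.restrict (Icc (0:ℝ) 1)) (f ⁻¹' Icc p q) := by
        rw [← hbox]
        exact measure_mono fun u hu => hf u fun j => hu j (mem_univ j)
    _ = volume.restrict (Icc (0:ℝ) 1) (Icc p q) := by
        rw [← Measure.map_apply hmeas measurableSet_Icc, hunif]
    _ ≤ volume (Icc p q) := Measure.restrict_apply_le _ _
    _ = ENNReal.ofReal (q - p) := Real.volume_Icc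

/-- If `b n ∈ [∏ x j n, 1]`, the exponential decay rate of `b` is at most the sum of the rates of
the factors. -/
theorem limsup_neg_log_le_sum_of_prod_le {ι : Type*} [Fintype ι] {x : ι → ℕ → ℝ} {b : ℕ → ℝ}
    {c : ι → ℝ} (hx : ∀ j n, 0 < x j n) (hxb : ∀ n, ∏ j, x j n ≤ b n) (hb : ∀ n, b n ≤ 1)
    (hlim : ∀ j, Tendsto (fun n : ℕ => -(1/(n:ℝ)) * Real.log (x j n)) atTop (nhds (c j))) :
    limsup (fun n : ℕ => -(1/(n:ℝ)) * Real.log (b n)) atTop ≤ ∑ j, c j := by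
  have hpos : ∀ n, 0 < ∏ j, x j n := fun n => Finset.prod_pos fun j _ => hx j n
  have hsum := tendsto_finsetSum Finset.univ fun j _ => hlim j
  rw [← hsum.limsup_eq]
  refine limsup_le_limsup (Eventually.of_forall fun n => ?_) ?_ hsum.isBoundedUnder_le
  · dsimp only
    rw [← Finset.mul_sum, ← Real.log_prod fun j _ => (hx j n).ne']
    exact mul_le_mul_of_nonpos_left (Real.log_le_log (hpos n) (hxb n))
      (neg_nonpos.2 (by positivity))
  · refine IsBoundedUnder.isCoboundedUnder_le ⟨0, eventually_map.2 (Eventually.of_forall fun n => ?_)⟩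
    exact mul_nonneg_of_nonpos_of_nonpos (neg_nonpos.2 (by positivity))
      (Real.log_nonpos ((hpos n).le.trans (hxb n)) (hb n))

/-- **Theorem 3.2 (upper-bound part).** For a monotone exact combination rule `Hc`
(i.e. `Hc (U₁, …, U_L)` is uniform on `[0,1]` for independent uniform `Uᵢ`), if the
inputs satisfy `-(1/n) log a_{j,n} → c_j`, then
`limsup_n -(1/n) log Hc(a_{1,n}, …, a_{L,n}) ≤ ∑ c_j`; similarly for the upper tails. -/
theorem combined_cd_bahadur_slope_upper_bound
    (L : ℕ) (hL : 1 ≤ L) (Hc : (Fin L → ℝ) → ℝ)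
    (hmeas : Measurable Hc)
    (hrange : ∀ u : Fin L → ℝ, (∀ i, u i ∈ Icc (0:ℝ) 1) → Hc u ∈ Icc (0:ℝ) 1)
    (hmono : ∀ (i : Fin L) (u : Fin L → ℝ), (∀ j, u j ∈ Icc (0:ℝ) 1) →
      ∀ x ∈ Icc (0:ℝ) 1, ∀ y ∈ Icc (0:ℝ) 1, x ≤ y →
        Hc (Function.update u i x) ≤ Hc (Function.update u i y))
    (hunif : Measure.map Hc (Measure.pi fun _ : Fin L => volume.restrict (Icc (0:ℝ) 1))
      = volume.restrict (Icc (0:ℝ) 1))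
    (c d : Fin L → ℝ) (hc : ∀ j, 0 ≤ c j) (hd : ∀ j, 0 ≤ d j)
    (a : Fin L → ℕ → ℝ) (ha : ∀ j n, a j n ∈ Ioo (0:ℝ) 1) :
    ((∀ j, Tendsto (fun n : ℕ => -(1/(n:ℝ)) * Real.log (a j n)) atTop (nhds (c j))) →
      limsup (fun n : ℕ => -(1/(n:ℝ)) * Real.log (Hc (fun j => a j n))) atTop ≤ ∑ j, c j)
    ∧
    ((∀ j, Tendsto (fun n : ℕ => -(1/(n:ℝ)) * Real.log (1 - a j n)) atTop (nhds (d j))) →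
      limsup (fun n : ℕ => -(1/(n:ℝ)) * Real.log (1 - Hc (fun j => a j n))) atTop ≤ ∑ j, d j) := by
  have haI : ∀ n j, a j n ∈ Icc (0:ℝ) 1 := fun n j => Ioo_subset_Icc_self (ha j n)
  have hHc : ∀ n, Hc (fun j => a j n) ∈ Icc (0:ℝ) 1 := fun n => hrange _ (haI n)
  refine ⟨limsup_neg_log_le_sum_of_prod_le (fun j n => (ha j n).1) (fun n => ?_)
      fun n => (hHc n).2,
    limsup_neg_log_le_sum_of_prod_le (fun j n => sub_pos.2 (ha j n).2) (fun n => ?_)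
      fun n => sub_le_self _ (hHc n).1⟩
  · have h := prod_sub_le_of_map_uniform_s1 hmeas hunif (l := fun _ => 0) (r := fun j => a j n)
      (fun _ => le_rfl) (fun j => (haI n j).1) (fun j => (haI n j).2) (hHc n).1 fun u hu => by
        have hu' : ∀ j, u j ∈ Icc (0:ℝ) 1 := fun j => ⟨(hu j).1, (hu j).2.trans (haI n j).2⟩
        exact ⟨(hrange u hu').1,
          apply_le_apply_of_update_le hmono hu' (haI n) fun j => (hu j).2⟩
    simpa using h
  · exact prod_sub_le_of_map_uniform_s1 hmeas hunif (l := fun j => a j n) (r := fun _ => 1)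
      (fun j => (haI n j).1) (fun j => (haI n j).2) (fun _ => le_rfl) (hHc n).2 fun u hu => by
        have hu' : ∀ j, u j ∈ Icc (0:ℝ) 1 := fun j => ⟨(haI n j).1.trans (hu j).1, (hu j).2⟩
        exact ⟨apply_le_apply_of_update_le hmono (haI n) hu' fun j => (hu j).1,
          (hrange u hu').2⟩
end

section
/- Let L ≥ 1, and let λ_1, …, λ_L > 0 and s_1, …, s_L > 0. Let μ be the chi-square distribution with 2L degrees of freedom, i.e., the Gamma distribution with shape L and rate 1/2. For each j = 1, …, L, let (u_{j,n})_{n≥1} be a sequence in (0,1) with −(1/n) log u_{j,n} → λ_j s_j as n → ∞. Then −(1/n) · log μ(( −2 Σ_{j=1}^L log u_{j,n}, ∞)) → Σ_{j=1}^L λ_j s_j as n → ∞. -/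
open MeasureTheory ProbabilityTheory Set Filter
open scoped Topology

lemma lintegral_Ioi_exp_neg_mul {c : ℝ} (hc : 0 < c) (x : ℝ) :
    ∫⁻ y in Ioi x, ENNReal.ofReal (Real.exp (-c * y))
      = ENNReal.ofReal (Real.exp (-c * x) / c) := by
  rw [← ofReal_integral_eq_lintegral_ofReal (integrableOn_exp_mul_Ioi (by linarith) x)
    (ae_of_all _ fun y => (Real.exp_pos _).le), integral_exp_mul_Ioi (by linarith) x]
  rw [neg_div_neg_eq]

lemma tendsto_neg_log_exp_div_div {c : ℝ} (hc : 0 < c) :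
    Tendsto (fun x : ℝ => -Real.log (Real.exp (-c * x) / c) / x) atTop (𝓝 c) := by
  have h : Tendsto (fun x : ℝ => c + Real.log c / x) atTop (𝓝 (c + 0)) :=
    tendsto_const_nhds.add (tendsto_const_nhds.div_atTop tendsto_id)
  rw [add_zero] at h
  refine h.congr' ?_
  filter_upwards [eventually_gt_atTop 0] with x hx
  rw [Real.log_div (Real.exp_pos _).ne' hc.ne', Real.log_exp]
  field_simp
  ring

/-- If a density decays at exponential rate `r`, so does its tail integral. -/
lemma tendsto_neg_log_lintegral_Ioi_div {f : ℝ → ℝ} {r : ℝ} (hr : 0 < r)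
    (hf : ∀ᶠ x in atTop, 0 < f x)
    (h : Tendsto (fun x => -Real.log (f x) / x) atTop (𝓝 r)) :
    Tendsto (fun x => -Real.log (∫⁻ y in Ioi x, ENNReal.ofReal (f y)).toReal / x)
      atTop (𝓝 r) := by
  have upper : ∀ c, 0 < c → c < r → ∀ᶠ x in atTop,
      ∫⁻ y in Ioi x, ENNReal.ofReal (f y) ≤ ENNReal.ofReal (Real.exp (-c * x) / c) := by
    intro c hc hcr
    have hle : ∀ᶠ y in atTop, f y ≤ Real.exp (-c * y) := by
      filter_upwards [h.eventually_const_lt hcr, hf, eventually_gt_atTop 0] with y hy hfy hy0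
      rw [lt_div_iff₀ hy0] at hy
      rw [← Real.log_le_iff_le_exp hfy]
      linarith
    filter_upwards [eventually_forall_ge_atTop.2 hle] with x hx
    rw [← lintegral_Ioi_exp_neg_mul hc]
    exact setLIntegral_mono' measurableSet_Ioi
      fun y hy => ENNReal.ofReal_le_ofReal (hx y (le_of_lt hy))
  have lower : ∀ c, r < c → ∀ᶠ x in atTop,
      ENNReal.ofReal (Real.exp (-c * x) / c) ≤ ∫⁻ y in Ioi x, ENNReal.ofReal (f y) := by
    intro c hcr
    have hle : ∀ᶠ y in atTop, Real.exp (-c * y) ≤ f y := by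
      filter_upwards [h.eventually_lt_const hcr, hf, eventually_gt_atTop 0] with y hy hfy hy0
      rw [div_lt_iff₀ hy0] at hy
      rw [← Real.le_log_iff_exp_le hfy]
      linarith
    filter_upwards [eventually_forall_ge_atTop.2 hle] with x hx
    rw [← lintegral_Ioi_exp_neg_mul (hr.trans hcr)]
    exact setLIntegral_mono' measurableSet_Ioi
      fun y hy => ENNReal.ofReal_le_ofReal (hx y (le_of_lt hy))
  have finite : ∀ᶠ x in atTop, ∫⁻ y in Ioi x, ENNReal.ofReal (f y) ≠ ⊤ := by
    filter_upwards [upper (r / 2) (by linarith) (by linarith)] with x hx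
    exact ne_top_of_le_ne_top ENNReal.ofReal_ne_top hx
  have lower_toReal : ∀ c, r < c → ∀ᶠ x in atTop,
      Real.exp (-c * x) / c ≤ (∫⁻ y in Ioi x, ENNReal.ofReal (f y)).toReal := by
    intro c hcr
    filter_upwards [lower c hcr, finite] with x hx hfin
    exact (ENNReal.ofReal_le_iff_le_toReal hfin).1 hx
  have pos : ∀ᶠ x in atTop, 0 < (∫⁻ y in Ioi x, ENNReal.ofReal (f y)).toReal := by
    filter_upwards [lower_toReal (r + 1) (by linarith)] with x hx
    exact lt_of_lt_of_le (by positivity) hx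
  refine tendsto_order.2 ⟨fun b hb => ?_, fun b hb => ?_⟩
  · obtain ⟨c, hbc, hcr⟩ := exists_between (max_lt hb hr)
    obtain ⟨hbc, hc⟩ := max_lt_iff.1 hbc
    filter_upwards [upper c hc hcr, pos, eventually_gt_atTop 0,
      (tendsto_neg_log_exp_div_div hc).eventually_const_lt hbc] with x hx hpos hx0 hbx
    refine hbx.trans_le ?_
    have := Real.log_le_log hpos (ENNReal.toReal_le_of_le_ofReal (by positivity) hx)
    gcongr
  · obtain ⟨c, hrc, hcb⟩ := exists_between hb
    have hc := hr.trans hrc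
    filter_upwards [lower_toReal c hrc, eventually_gt_atTop 0,
      (tendsto_neg_log_exp_div_div hc).eventually_lt_const hcb] with x hx hx0 hbx
    refine lt_of_le_of_lt ?_ hbx
    have := Real.log_le_log (by positivity) hx
    gcongr

lemma tendsto_neg_log_gammaPDFReal_div {a r : ℝ} (ha : 0 < a) (hr : 0 < r) :
    Tendsto (fun x => -Real.log (gammaPDFReal a r x) / x) atTop (𝓝 r) := by
  have hlog : Tendsto (fun x : ℝ => Real.log x / x) atTop (𝓝 0) :=
    Real.isLittleO_log_id_atTop.tendsto_div_nhds_zero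
  have h : Tendsto (fun x : ℝ => r - Real.log (r ^ a / Real.Gamma a) / x
      - (a - 1) * (Real.log x / x)) atTop (𝓝 (r - 0 - (a - 1) * 0)) :=
    (tendsto_const_nhds.sub (tendsto_const_nhds.div_atTop tendsto_id)).sub
      (tendsto_const_nhds.mul hlog)
  rw [mul_zero, sub_zero, sub_zero] at h
  refine h.congr' ?_
  filter_upwards [eventually_gt_atTop 0] with x hx
  have hK : 0 < r ^ a / Real.Gamma a :=
    div_pos (Real.rpow_pos_of_pos hr a) (Real.Gamma_pos_of_pos ha)
  have hxa : 0 < x ^ (a - 1) := Real.rpow_pos_of_pos hx _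
  rw [gammaPDFReal, if_pos hx.le, Real.log_mul (mul_pos hK hxa).ne' (Real.exp_pos _).ne',
    Real.log_mul hK.ne' hxa.ne', Real.log_exp, Real.log_rpow hx]
  field_simp
  ring

lemma tendsto_neg_log_gammaMeasure_Ioi_div {a r : ℝ} (ha : 0 < a) (hr : 0 < r) :
    Tendsto (fun x => -Real.log (gammaMeasure a r (Ioi x)).toReal / x) atTop (𝓝 r) := by
  simp_rw [gammaMeasure, withDensity_apply _ measurableSet_Ioi]
  exact tendsto_neg_log_lintegral_Ioi_div hr
    ((eventually_gt_atTop 0).mono fun x hx => gammaPDFReal_pos ha hr hx)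
    (tendsto_neg_log_gammaPDFReal_div ha hr)

/-- **Theorem 3.2 (slope attainment for the Fisher-type combination).** If
`-(1/n) log u_{j,n} → λ_j s_j` for each `j`, then, with `μ` the chi-square distribution with
`2L` degrees of freedom (the Gamma distribution with shape `L` and rate `1/2`),
`-(1/n) log μ((-2 ∑_j log u_{j,n}, ∞)) → ∑_j λ_j s_j`. -/
theorem fisher_combination_slope
    (L : ℕ) (hL : 1 ≤ L) (lam s : Fin L → ℝ)
    (hlam : ∀ j, 0 < lam j) (hs : ∀ j, 0 < s j)
    (u : Fin L → ℕ → ℝ) (hu : ∀ j n, u j n ∈ Ioo (0:ℝ) 1)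
    (hconv : ∀ j, Tendsto (fun n : ℕ => -(1/(n:ℝ)) * Real.log (u j n))
      atTop (nhds (lam j * s j))) :
    Tendsto (fun n : ℕ =>
        -(1/(n:ℝ)) * Real.log
          ((gammaMeasure (L : ℝ) (1/2)) (Ioi (-2 * ∑ j, Real.log (u j n)))).toReal)
      atTop (nhds (∑ j, lam j * s j)) := by
  have : NeZero L := ⟨by omega⟩
  have hS : 0 < ∑ j, lam j * s j :=
    Finset.sum_pos (fun j _ => mul_pos (hlam j) (hs j)) Finset.univ_nonempty
  have hratio : Tendsto (fun n : ℕ => (-2 * ∑ j, Real.log (u j n)) / n) atTop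
      (𝓝 (2 * ∑ j, lam j * s j)) := by
    refine ((tendsto_finsetSum Finset.univ fun j _ => hconv j).const_mul 2).congr fun n => ?_
    rw [← Finset.mul_sum]
    ring
  have htop : Tendsto (fun n : ℕ => -2 * ∑ j, Real.log (u j n)) atTop atTop := by
    refine (hratio.pos_mul_atTop (by positivity) tendsto_natCast_atTop_atTop).congr' ?_
    filter_upwards [eventually_gt_atTop 0] with n hn
    exact div_mul_cancel₀ _ (by positivity)
  have htail := (tendsto_neg_log_gammaMeasure_Ioi_div (a := L) (r := 1 / 2)
    (by exact_mod_cast hL) (by norm_num)).comp htop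
  have hlim := htail.mul hratio
  rw [show (1 / 2 : ℝ) * (2 * ∑ j, lam j * s j) = ∑ j, lam j * s j by ring] at hlim
  refine hlim.congr' ?_
  filter_upwards [htop.eventually_gt_atTop 0] with n hn
  rw [Function.comp_apply, div_mul_div_cancel₀ hn.ne']
  ring
end

section
/- For each integer L ≥ 1 there exists a polynomial V_L of degree L − 1 such that for all t > 0, 1 − DE_L(t) = DE_L(−t) = (1/2) V_L(t) e^{−t}. Moreover V_1(t) = 1, V_2(t) = 1 + t/2, and the sequence of polynomials satisfies, for every k ≥ 2, the recursion 2 V_k(t) = V_{k−1}(t) + ∫_0^t [V_{k−1}(s) − V′_{k−1}(s)] ds + ∫_0^∞ [V_{k−1}(s) + V_{k−1}(t+s) − V′_{k−1}(s)] e^{−2s} ds for all t > 0. -/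
open MeasureTheory Set

/-- The standard double exponential (Laplace) distribution: the measure on `ℝ`
with Lebesgue density `(1/2) e^{-|t|}`. -/
noncomputable def laplaceMeasure : Measure ℝ :=
  volume.withDensity fun t => ENNReal.ofReal ((1/2) * Real.exp (-|t|))

/-- `DEL L t` is the CDF, evaluated at `t`, of the sum of `L` independent standard
Laplace random variables (the `L`-fold convolution `DE ∗ ⋯ ∗ DE`). -/
noncomputable def DEL (L : ℕ) (t : ℝ) : ℝ :=
  ((Measure.pi fun _ : Fin L => laplaceMeasure) {x | ∑ i, x i ≤ t}).toReal

open Filter Topology Polynomial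

section Laplace

lemma integrable_laplaceDensity :
    Integrable fun t : ℝ => (1 / 2) * Real.exp (-|t|) := by
  refine Integrable.const_mul ?_ _
  have h : IntegrableOn (fun x : ℝ => Real.exp (-|x|)) (Iic 0 ∪ Ioi 0) := by
    refine IntegrableOn.union ?_ ?_
    · refine (integrableOn_exp_Iic 0).congr_fun (fun x hx => ?_) measurableSet_Iic
      simp [abs_of_nonpos (show x ≤ 0 from hx)]
    · refine (integrableOn_exp_neg_Ioi 0).congr_fun (fun x hx => ?_) measurableSet_Ioi
      simp [abs_of_pos (show 0 < x from hx)]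
  rwa [Iic_union_Ioi, integrableOn_univ] at h

lemma integral_laplaceDensity : ∫ t : ℝ, (1 / 2) * Real.exp (-|t|) = 1 := by
  rw [integral_const_mul, integral_comp_abs (f := fun x => Real.exp (-x)),
    integral_exp_neg_Ioi_zero]
  norm_num

instance : IsProbabilityMeasure laplaceMeasure := by
  constructor
  rw [laplaceMeasure, withDensity_apply _ MeasurableSet.univ, Measure.restrict_univ,
    ← ofReal_integral_eq_lintegral_ofReal integrable_laplaceDensity
      (ae_of_all _ fun t => by positivity), integral_laplaceDensity, ENNReal.ofReal_one]

lemma integral_laplaceMeasure (f : ℝ → ℝ) :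
    ∫ y, f y ∂laplaceMeasure = ∫ y, f y * ((1 / 2) * Real.exp (-|y|)) := by
  rw [laplaceMeasure, integral_withDensity_eq_integral_toReal_smul (by fun_prop)
    (ae_of_all _ fun _ => ENNReal.ofReal_lt_top)]
  refine integral_congr_ae (ae_of_all _ fun y => ?_)
  simp only [smul_eq_mul]
  rw [ENNReal.toReal_ofReal (by positivity), mul_comm]

lemma measurableSet_sum_le (n : ℕ) (t : ℝ) : MeasurableSet {x : Fin n → ℝ | ∑ i, x i ≤ t} :=
  measurableSet_le (by fun_prop) measurable_const

lemma DEL_nonneg (n : ℕ) (t : ℝ) : 0 ≤ DEL n t := ENNReal.toReal_nonneg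

lemma DEL_le_one (n : ℕ) (t : ℝ) : DEL n t ≤ 1 :=
  ENNReal.toReal_le_of_le_ofReal zero_le_one (by simpa using prob_le_one)

lemma DEL_monotone (n : ℕ) : Monotone (DEL n) := fun _ _ h =>
  ENNReal.toReal_mono (measure_ne_top _ _) (measure_mono fun _ hx => le_trans hx h)

lemma DEL_zero (t : ℝ) : DEL 0 t = if 0 ≤ t then 1 else 0 := by
  by_cases h : 0 ≤ t <;> simp [DEL, h]

lemma DEL_succ (n : ℕ) (t : ℝ) :
    DEL (n + 1) t = ∫ y, DEL n (t - y) * ((1 / 2) * Real.exp (-|y|)) := by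
  rw [← integral_laplaceMeasure]
  have h := (measurePreserving_piFinSuccAbove (fun _ : Fin (n + 1) => laplaceMeasure) 0).symm
  have hm := measurableSet_sum_le (n + 1) t
  rw [DEL, ← h.measure_preimage hm.nullMeasurableSet,
    Measure.prod_apply (h.measurable hm)]
  have hs : ∀ y : ℝ, Measure.pi (fun _ : Fin n => laplaceMeasure)
      (Prod.mk y ⁻¹' ((MeasurableEquiv.piFinSuccAbove (fun _ : Fin (n + 1) => ℝ) 0).symm ⁻¹'
        {x | ∑ i, x i ≤ t})) = ENNReal.ofReal (DEL n (t - y)) := by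
    intro y
    rw [DEL, ENNReal.ofReal_toReal (measure_ne_top _ _)]
    congr 1
    ext x
    simp [MeasurableEquiv.piFinSuccAbove, Fin.sum_univ_succ, le_sub_iff_add_le']
  have hm' : Measurable fun y => DEL n (t - y) :=
    (DEL_monotone n).measurable.comp (measurable_const.sub measurable_id)
  rw [integral_eq_lintegral_of_nonneg_ae (ae_of_all _ fun y => DEL_nonneg _ _)
    hm'.aestronglyMeasurable]
  exact congrArg _ (lintegral_congr hs)

lemma integrable_DEL_mul (n : ℕ) (t : ℝ) :
    Integrable fun y => DEL n (t - y) * ((1 / 2) * Real.exp (-|y|)) := by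
  refine integrable_laplaceDensity.bdd_mul (c := 1)
    ((DEL_monotone n).measurable.comp
      (measurable_const.sub measurable_id)).aestronglyMeasurable (ae_of_all _ fun y => ?_)
  rw [Real.norm_of_nonneg (DEL_nonneg _ _)]
  exact DEL_le_one _ _

lemma DEL_succ_neg_of_ae (n : ℕ) (h : ∀ᵐ u : ℝ, DEL n (-u) = 1 - DEL n u) (t : ℝ) :
    DEL (n + 1) (-t) = 1 - DEL (n + 1) t := by
  rw [DEL_succ, DEL_succ, ← integral_neg_eq_self]
  conv_rhs =>
    lhs
    rw [← integral_laplaceDensity]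
  rw [← integral_sub integrable_laplaceDensity (integrable_DEL_mul n t)]
  have h' : ∀ᵐ y : ℝ, DEL n (-(t - y)) = 1 - DEL n (t - y) :=
    (Measure.measurePreserving_sub_left volume t).quasiMeasurePreserving.ae h
  refine integral_congr_ae (h'.mono fun y hy => ?_)
  have e : -t - -y = -(t - y) := by ring
  simp only [e, hy, abs_neg]
  ring

lemma DEL_neg (n : ℕ) (hn : 1 ≤ n) (t : ℝ) : DEL n (-t) = 1 - DEL n t := by
  induction n, hn using Nat.le_induction generalizing t with
  | base =>
    refine DEL_succ_neg_of_ae 0 ?_ t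
    filter_upwards [compl_mem_ae_iff.2 (measure_singleton (0 : ℝ))] with u hu
    rcases lt_or_gt_of_ne (show u ≠ 0 from hu) with h | h
    · simp [DEL_zero, h.le, h.not_ge]
    · simp [DEL_zero, h.le, h.not_ge]
  | succ n _ ih => exact DEL_succ_neg_of_ae n (ae_of_all _ ih) t

lemma DEL_one_neg {t : ℝ} (ht : 0 ≤ t) : DEL 1 (-t) = 1 / 2 * Real.exp (-t) := by
  rw [DEL_succ]
  have : (fun y => DEL 0 (-t - y) * ((1 / 2) * Real.exp (-|y|)))
      = (Iic (-t)).indicator fun y => (1 / 2) * Real.exp y := by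
    ext y
    by_cases hy : y ≤ -t
    · simp [DEL_zero, hy, abs_of_nonpos (show y ≤ 0 by linarith)]
    · simp [DEL_zero, hy]
  rw [this, integral_indicator measurableSet_Iic, integral_const_mul, integral_exp_Iic]

end Laplace

section ExpIntegral

variable (P Q : ℝ[X])

lemma tendsto_eval_mul_exp_neg_two :
    Tendsto (fun s : ℝ => P.eval s * Real.exp (-2 * s)) atTop (𝓝 0) := by
  have h := P.tendsto_div_exp_atTop.mul Real.tendsto_exp_neg_atTop_nhds_zero
  rw [zero_mul] at h
  refine h.congr fun s => ?_
  rw [div_eq_mul_inv, ← Real.exp_neg, mul_assoc, ← Real.exp_add]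
  ring_nf

lemma integrableOn_eval_mul_exp_neg_two (a : ℝ) :
    IntegrableOn (fun s : ℝ => P.eval s * Real.exp (-2 * s)) (Ioi a) := by
  refine integrable_of_isBigO_exp_neg (b := 1) one_pos (by fun_prop) ?_
  have h := (P.tendsto_div_exp_atTop.isBigO_one ℝ).mul
    (Asymptotics.isBigO_refl (fun s : ℝ => Real.exp (-1 * s)) atTop)
  refine h.congr (fun s => ?_) fun s => one_mul _
  rw [div_eq_mul_inv, ← Real.exp_neg, mul_assoc, ← Real.exp_add]
  ring_nf

variable {P Q}

lemma hasDerivAt_eval_mul_exp_neg_two (h : C 2 * Q - derivative Q = P) (s : ℝ) :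
    HasDerivAt (fun s : ℝ => -(Q.eval s * Real.exp (-2 * s))) (P.eval s * Real.exp (-2 * s)) s := by
  have h1 : HasDerivAt (fun s : ℝ => Real.exp (-2 * s)) (Real.exp (-2 * s) * (-2 * 1)) s :=
    ((hasDerivAt_id s).const_mul (-2)).exp
  refine ((Q.hasDerivAt s).mul h1).neg.congr_deriv ?_
  rw [← h]
  simp only [eval_sub, eval_mul, eval_C]
  ring

lemma integral_Ioi_eval_mul_exp_neg_two (h : C 2 * Q - derivative Q = P) :
    ∫ s in Ioi (0 : ℝ), P.eval s * Real.exp (-2 * s) = Q.eval 0 := by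
  rw [integral_Ioi_of_hasDerivAt_of_tendsto' (fun s _ => hasDerivAt_eval_mul_exp_neg_two h s)
    (integrableOn_eval_mul_exp_neg_two P 0) (tendsto_eval_mul_exp_neg_two Q).neg]
  simp

end ExpIntegral

section Polynomials

/-- The polynomial solution `Q` of `2 Q - Q' = P`. -/
noncomputable def expResolvent (P : ℝ[X]) : ℝ[X] :=
  ∑ j ∈ Finset.range (P.natDegree + 1), C ((1 / 2 : ℝ) ^ (j + 1)) * derivative^[j] P

/-- The antiderivative of `P` vanishing at `0`. -/
noncomputable def primitive (P : ℝ[X]) : ℝ[X] :=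
  ∑ j ∈ Finset.range (P.natDegree + 1), C (P.coeff j / (j + 1)) * X ^ (j + 1)

lemma two_mul_expResolvent_sub_derivative (P : ℝ[X]) :
    C 2 * expResolvent P - derivative (expResolvent P) = P := by
  have key : ∀ n : ℕ, C 2 * (∑ j ∈ Finset.range n, C ((1 / 2 : ℝ) ^ (j + 1)) * derivative^[j] P)
      - derivative (∑ j ∈ Finset.range n, C ((1 / 2 : ℝ) ^ (j + 1)) * derivative^[j] P)
      = P - C ((1 / 2 : ℝ) ^ n) * derivative^[n] P := by
    intro n
    induction n with
    | zero => simp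
    | succ n ih =>
      rw [Finset.sum_range_succ, mul_add, derivative_add, add_sub_add_comm, ih,
        derivative_C_mul, ← Function.iterate_succ_apply' derivative, ← mul_assoc, ← C_mul,
        show (2 : ℝ) * (1 / 2) ^ (n + 1) = (1 / 2) ^ n by rw [pow_succ]; ring]
      ring
  rw [expResolvent, key, iterate_derivative_eq_zero (Nat.lt_succ_self _), mul_zero, sub_zero]

lemma natDegree_expResolvent_le (P : ℝ[X]) : (expResolvent P).natDegree ≤ P.natDegree :=
  natDegree_sum_le_of_forall_le _ _ fun j _ =>
    (natDegree_C_mul_le _ _).trans ((natDegree_iterate_derivative P j).trans (Nat.sub_le _ _))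

lemma derivative_primitive (P : ℝ[X]) : derivative (primitive P) = P := by
  conv_rhs => rw [P.as_sum_range_C_mul_X_pow]
  rw [primitive, derivative_sum]
  refine Finset.sum_congr rfl fun j _ => ?_
  rw [derivative_C_mul_X_pow]
  congr 2
  push_cast
  field_simp

lemma eval_zero_primitive (P : ℝ[X]) : (primitive P).eval 0 = 0 := by
  simp [primitive, eval_finsetSum]

lemma natDegree_primitive {P : ℝ[X]} (hP : P ≠ 0) :
    (primitive P).natDegree = P.natDegree + 1 := by
  refine le_antisymm ?_ ?_
  · refine natDegree_sum_le_of_forall_le _ _ fun j hj => (natDegree_C_mul_X_pow_le _ _).trans ?_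
    have := Finset.mem_range.1 hj
    omega
  · have h0 : (primitive P).natDegree ≠ 0 := by
      intro h
      apply hP
      rw [← derivative_primitive P, eq_C_of_natDegree_eq_zero h, derivative_C]
    have h := natDegree_derivative_lt h0
    rw [derivative_primitive] at h
    omega

/-- The step `V_{k-1} ↦ V_k` of the recursion for the tail polynomials. -/
noncomputable def tailStep (P : ℝ[X]) : ℝ[X] :=
  C (1 / 2) * (primitive P + (expResolvent P + C (2 - (expResolvent P).eval 0)))

/-- The tail polynomials, indexed from `0`. -/
noncomputable def tailPoly (n : ℕ) : ℝ[X] := tailStep^[n] 1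

lemma tailPoly_succ (n : ℕ) : tailPoly (n + 1) = tailStep (tailPoly n) :=
  Function.iterate_succ_apply' _ _ _

lemma two_mul_eval_tailStep (P : ℝ[X]) (t : ℝ) : 2 * (tailStep P).eval t =
    (primitive P).eval t + (expResolvent P).eval t + 2 - (expResolvent P).eval 0 := by
  simp only [tailStep, eval_mul, eval_add, eval_C]
  ring

lemma eval_zero_tailPoly (n : ℕ) : (tailPoly n).eval 0 = 1 := by
  cases n with
  | zero => simp [tailPoly]
  | succ n =>
    have h := two_mul_eval_tailStep (tailPoly n) 0
    rw [eval_zero_primitive] at h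
    rw [tailPoly_succ]
    linarith

lemma tailPoly_ne_zero (n : ℕ) : tailPoly n ≠ 0 := fun h => by
  simpa [h] using eval_zero_tailPoly n

lemma natDegree_tailPoly (n : ℕ) : (tailPoly n).natDegree = n := by
  induction n with
  | zero => simp [tailPoly]
  | succ n ih =>
    have hI := natDegree_primitive (tailPoly_ne_zero n)
    have hQ : (expResolvent (tailPoly n) +
        C (2 - (expResolvent (tailPoly n)).eval 0)).natDegree ≤ (tailPoly n).natDegree := by
      rw [natDegree_add_C]
      exact natDegree_expResolvent_le _
    rw [tailPoly_succ, tailStep, natDegree_C_mul (by norm_num),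
      natDegree_add_eq_left_of_natDegree_lt (by omega), hI, ih]

lemma tailPoly_one : tailPoly 1 = C 1 + C (1 / 2) * X := by
  have h : tailPoly 1 = tailStep 1 := rfl
  rw [h]
  apply Polynomial.funext
  intro t
  have := two_mul_eval_tailStep 1 t
  simp [primitive, expResolvent] at this ⊢
  linarith

lemma setIntegral_derivative_eval {P Q : ℝ[X]} (h : derivative Q = P) {t : ℝ} (ht : 0 ≤ t) :
    ∫ s in Ioc (0 : ℝ) t, P.eval s = Q.eval t - Q.eval 0 := by
  rw [← intervalIntegral.integral_of_le ht]
  refine intervalIntegral.integral_eq_sub_of_hasDerivAt (f := fun s => Q.eval s) (fun s _ => ?_)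
    (P.continuous.intervalIntegrable _ _)
  rw [← h]
  exact Q.hasDerivAt s

lemma tailPoly_recursion (n : ℕ) {t : ℝ} (ht : 0 < t) :
    2 * (tailPoly (n + 1)).eval t
      = (tailPoly n).eval t
        + (∫ s in Ioc (0 : ℝ) t, ((tailPoly n).eval s - (derivative (tailPoly n)).eval s))
        + (∫ s in Ioi (0 : ℝ), ((tailPoly n).eval s + (tailPoly n).eval (t + s)
            - (derivative (tailPoly n)).eval s) * Real.exp (-2 * s)) := by
  set P := tailPoly n with hP
  set Q := expResolvent P with hQ
  have hQP : C 2 * Q - derivative Q = P := two_mul_expResolvent_sub_derivative P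
  have hPQ0 : 2 * Q.eval 0 - (derivative Q).eval 0 = 1 := by
    rw [← eval_zero_tailPoly n, ← hP]
    conv_rhs => rw [← hQP]
    simp
  have h1 : ∫ s in Ioc (0 : ℝ) t, (P.eval s - (derivative P).eval s)
      = (primitive P).eval t - P.eval t + 1 := by
    have := setIntegral_derivative_eval (P := P - derivative P) (Q := primitive P - P)
      (by rw [derivative_sub, derivative_primitive]) ht.le
    simp only [eval_sub] at this
    rw [this, eval_zero_primitive, hP, eval_zero_tailPoly]
    ring
  have h2 : ∫ s in Ioi (0 : ℝ), (P.eval s + P.eval (t + s) - (derivative P).eval s)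
      * Real.exp (-2 * s) = Q.eval 0 + Q.eval t - (derivative Q).eval 0 := by
    have := integral_Ioi_eval_mul_exp_neg_two (P := P + P.comp (C t + X) - derivative P)
      (Q := Q + Q.comp (C t + X) - derivative Q) (by
        rw [← hQP]
        simp [derivative_comp]
        ring)
    simpa using this
  rw [h1, h2, hP, tailPoly_succ, two_mul_eval_tailStep, ← hP, ← hQ]
  linarith

end Polynomials

lemma DEL_succ_neg_of_tail {n : ℕ} (hn : 1 ≤ n) {P : ℝ[X]}
    (hP : ∀ t, 0 ≤ t → DEL n (-t) = 1 / 2 * P.eval t * Real.exp (-t)) {t : ℝ} (ht : 0 ≤ t) :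
    DEL (n + 1) (-t) = 1 / 2 * (tailStep P).eval t * Real.exp (-t) := by
  set Q := expResolvent P with hQ
  have hQP : C 2 * Q - derivative Q = P := two_mul_expResolvent_sub_derivative P
  have hint := integrable_DEL_mul n (-t)
  have hright : ∫ y in Ioi 0, DEL n (-t - y) * (1 / 2 * Real.exp (-|y|))
      = 1 / 4 * Real.exp (-t) * Q.eval t := by
    have h := integral_Ioi_eval_mul_exp_neg_two (P := P.comp (C t + X))
      (Q := Q.comp (C t + X)) (by
        rw [← hQP]
        simp [derivative_comp])
    rw [show Q.eval t = (Q.comp (C t + X)).eval 0 by simp, ← h, ← integral_const_mul]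
    refine setIntegral_congr_fun measurableSet_Ioi fun y (hy : 0 < y) => ?_
    have e : -t - y = -(t + y) := by ring
    simp only [e]
    rw [hP _ (by linarith), abs_of_pos hy, eval_comp, eval_add, eval_C, eval_X, neg_add,
      Real.exp_add, show -2 * y = -y + -y by ring, Real.exp_add]
    ring
  have hmid : ∫ y in Ioc (-t) 0, DEL n (-t - y) * (1 / 2 * Real.exp (-|y|))
      = 1 / 4 * Real.exp (-t) * (primitive P).eval t := by
    have h : ∫ y in (-t)..0, (P.comp (C t + X)).eval y = (primitive P).eval t := by
      simp only [eval_comp, eval_add, eval_C, eval_X]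
      rw [intervalIntegral.integral_comp_add_left (fun x => P.eval x), add_neg_cancel, add_zero,
        intervalIntegral.integral_of_le ht,
        setIntegral_derivative_eval (derivative_primitive P) ht, eval_zero_primitive, sub_zero]
    rw [← h, intervalIntegral.integral_of_le (by linarith), ← integral_const_mul]
    refine setIntegral_congr_fun measurableSet_Ioc fun y hy => ?_
    have e : -t - y = -(t + y) := by ring
    simp only [e]
    rw [hP _ (by linarith [hy.1]), abs_of_nonpos hy.2, eval_comp, eval_add, eval_C, eval_X,
      neg_add, Real.exp_add, neg_neg]
    have : Real.exp (-y) * Real.exp y = 1 := by rw [← Real.exp_add]; simp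
    linear_combination (1 / 4 * P.eval (t + y) * Real.exp (-t)) * this
  have hleft : ∫ y in Iic (-t), DEL n (-t - y) * (1 / 2 * Real.exp (-|y|))
      = 1 / 4 * Real.exp (-t) * (2 - Q.eval 0) := by
    have hI : ∫ u in Ioi (0 : ℝ), (1 / 2 * Real.exp (-t)) *
        (Real.exp (-u) - 1 / 2 * (P.eval u * Real.exp (-2 * u)))
        = 1 / 4 * Real.exp (-t) * (2 - Q.eval 0) := by
      rw [integral_const_mul, integral_sub (integrableOn_exp_neg_Ioi 0)
        ((integrableOn_eval_mul_exp_neg_two P 0).const_mul _), integral_const_mul,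
        integral_Ioi_eval_mul_exp_neg_two hQP, integral_exp_neg_Ioi_zero]
      ring
    rw [← hI, ← integral_Ici_eq_integral_Ioi, ← integral_indicator measurableSet_Ici,
      ← integral_indicator measurableSet_Iic, ← integral_sub_left_eq_self _ volume (-t)]
    congr 1
    ext u
    by_cases hu : 0 ≤ u
    · rw [indicator_of_mem (show -t - u ∈ Iic (-t) by simpa using hu),
        indicator_of_mem (show u ∈ Ici 0 from hu), sub_sub_cancel, ← neg_neg u,
        DEL_neg n hn, neg_neg, hP u hu, abs_of_nonpos (by linarith), neg_neg,
        sub_eq_add_neg (-t) u, Real.exp_add, show -2 * u = -u + -u by ring, Real.exp_add]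
      ring
    · rw [indicator_of_notMem (show -t - u ∉ Iic (-t) by simpa using hu),
        indicator_of_notMem (show u ∉ Ici 0 from hu)]
  have htot : ∫ y, DEL n (-t - y) * (1 / 2 * Real.exp (-|y|))
      = 1 / 4 * Real.exp (-t) * (2 - Q.eval 0) + 1 / 4 * Real.exp (-t) * (primitive P).eval t
        + 1 / 4 * Real.exp (-t) * Q.eval t := by
    rw [← hleft, ← hmid, ← hright,
      ← setIntegral_union (Iic_disjoint_Ioc le_rfl) measurableSet_Ioc
        hint.integrableOn hint.integrableOn, Iic_union_Ioc_eq_Iic (by linarith),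
      intervalIntegral.integral_Iic_add_Ioi hint.integrableOn hint.integrableOn]
  rw [DEL_succ, htot]
  linear_combination (-1 / 4 * Real.exp (-t)) * two_mul_eval_tailStep P t

lemma DEL_succ_neg_eq_tailPoly (n : ℕ) {t : ℝ} (ht : 0 ≤ t) :
    DEL (n + 1) (-t) = 1 / 2 * (tailPoly n).eval t * Real.exp (-t) := by
  induction n generalizing t with
  | zero => simpa [tailPoly] using DEL_one_neg ht
  | succ n ih =>
    rw [tailPoly_succ]
    exact DEL_succ_neg_of_tail (Nat.le_add_left 1 n) (fun s hs => ih hs) ht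

/-- **Lemma 3.1.** For each `L ≥ 1` there is a polynomial `V_L` of degree `L - 1` with
`1 - DE_L(t) = DE_L(-t) = (1/2) V_L(t) e^{-t}` for `t > 0`; moreover `V₁(t) = 1`,
`V₂(t) = 1 + t/2`, and the sequence satisfies the stated integral recursion. -/
theorem laplace_convolution_tail_polynomial :
    ∃ V : ℕ → Polynomial ℝ,
      (∀ L : ℕ, 1 ≤ L → (V L).natDegree = L - 1 ∧
        ∀ t : ℝ, 0 < t →
          1 - DEL L t = DEL L (-t) ∧
          DEL L (-t) = (1/2) * (V L).eval t * Real.exp (-t)) ∧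
      V 1 = Polynomial.C 1 ∧
      V 2 = Polynomial.C 1 + Polynomial.C (1/2) * Polynomial.X ∧
      (∀ k : ℕ, 2 ≤ k → ∀ t : ℝ, 0 < t →
        2 * (V k).eval t
          = (V (k-1)).eval t
            + (∫ s in Ioc (0:ℝ) t,
                ((V (k-1)).eval s - ((V (k-1)).derivative).eval s))
            + (∫ s in Ioi (0:ℝ),
                ((V (k-1)).eval s + (V (k-1)).eval (t + s)
                  - ((V (k-1)).derivative).eval s) * Real.exp (-2 * s))) := by
  refine ⟨fun n => tailPoly (n - 1), fun L hL => ?_, by simp [tailPoly], tailPoly_one,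
    fun k hk t ht => ?_⟩
  · obtain ⟨n, rfl⟩ := Nat.exists_eq_add_of_le' hL
    exact ⟨natDegree_tailPoly n, fun t ht =>
      ⟨(DEL_neg _ hL t).symm, DEL_succ_neg_eq_tailPoly n ht.le⟩⟩
  · obtain ⟨n, rfl⟩ := Nat.exists_eq_add_of_le' hk
    exact tailPoly_recursion n ht
end

section
/- Let L ≥ 1 and let DE_L be the CDF of the sum of L independent standard Laplace random variables. Then lim_{t→∞} (1/t) · log(1 − DE_L(t)) = −1 and lim_{t→∞} (1/t) · log DE_L(−t) = −1. In particular, the exponential tail rate of DE_L is the same as that of a single standard Laplace distribution. -/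
open MeasureTheory Set Filter

/-- A function squeezed between `c e^{-t}` and `C e^{-st}`, for every `0 < s < 1`, has exponential
rate `-1`. -/
lemma tendsto_inv_mul_log_of_exp_bounds {f : ℝ → ℝ} {c : ℝ} (hc : 0 < c)
    (hlow : ∀ t, 0 < t → c * Real.exp (-t) ≤ f t)
    (hupp : ∀ s, 0 < s → s < 1 → ∃ C, ∀ t, 0 < t → f t ≤ Real.exp (-s * t) * C) :
    Tendsto (fun t : ℝ => (1/t) * Real.log (f t)) atTop (nhds (-1)) := by
  have hpos : ∀ t, 0 < t → 0 < f t := fun t ht => lt_of_lt_of_le (by positivity) (hlow t ht)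
  have hlim : ∀ a b : ℝ, Tendsto (fun t : ℝ => a / t + b) atTop (nhds b) := fun a b => by
    simpa using (tendsto_id.const_div_atTop a).add_const b
  refine tendsto_order.2 ⟨fun a ha => ?_, fun b hb => ?_⟩
  · filter_upwards [(hlim (Real.log c) (-1)).eventually_const_lt ha, eventually_gt_atTop 0]
      with t hat ht
    refine hat.trans_le ?_
    have h := Real.log_le_log (by positivity) (hlow t ht)
    rw [Real.log_mul hc.ne' (Real.exp_pos _).ne', Real.log_exp] at h
    calc Real.log c / t + -1 = 1 / t * (Real.log c + -t) := by field_simp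
      _ ≤ 1 / t * Real.log (f t) := by gcongr
  · obtain ⟨s, hs, hs1⟩ := exists_between (show max 0 (-b) < 1 from max_lt one_pos (by linarith))
    obtain ⟨hs0, hsb⟩ := max_lt_iff.1 hs
    obtain ⟨C, hC⟩ := hupp s hs0 hs1
    have hCpos : 0 < C := by
      have := (hpos 1 one_pos).trans_le (hC 1 one_pos)
      exact pos_of_mul_pos_right this (Real.exp_pos _).le
    filter_upwards [(hlim (Real.log C) (-s)).eventually_lt_const (show -s < b by linarith),
      eventually_gt_atTop 0] with t hbt ht
    refine lt_of_le_of_lt ?_ hbt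
    have h := Real.log_le_log (hpos t ht) (hC t ht)
    rw [Real.log_mul (Real.exp_pos _).ne' hCpos.ne', Real.log_exp] at h
    calc 1 / t * Real.log (f t) ≤ 1 / t * (-s * t + Real.log C) := by gcongr
      _ = Real.log C / t + -s := by field_simp; ring

lemma integrable_exp_neg_abs_mul_exp {s : ℝ} (hs : |s| < 1) :
    Integrable fun x : ℝ => Real.exp (-|x|) * Real.exp (s * x) := by
  obtain ⟨h1, h2⟩ := abs_lt.1 hs
  rw [← integrableOn_univ, ← Iic_union_Ioi (a := (0 : ℝ))]
  refine IntegrableOn.union ?_ ?_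
  · refine (integrableOn_exp_mul_Iic (a := 1 + s) (by linarith) 0).congr_fun
      (fun x hx => ?_) measurableSet_Iic
    simp only [← Real.exp_add, abs_of_nonpos (mem_Iic.1 hx)]
    ring_nf
  · refine (integrableOn_exp_mul_Ioi (a := s - 1) (by linarith) 0).congr_fun
      (fun x hx => ?_) measurableSet_Ioi
    simp only [← Real.exp_add, abs_of_pos (mem_Ioi.1 hx)]
    ring_nf

lemma laplaceMeasure_apply {A : Set ℝ} (hA : MeasurableSet A) :
    laplaceMeasure A = ENNReal.ofReal (∫ x in A, (1/2) * Real.exp (-|x|)) := by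
  have h : Integrable fun x : ℝ => (1/2) * Real.exp (-|x|) := by
    simpa using (integrable_exp_neg_abs_mul_exp (s := 0) (by simp)).const_mul (1/2)
  rw [laplaceMeasure, withDensity_apply _ hA, ofReal_integral_eq_lintegral_ofReal h.integrableOn]
  exact ae_of_all _ fun x => by positivity

lemma laplaceMeasure_Ioi {t : ℝ} (ht : 0 ≤ t) :
    laplaceMeasure (Ioi t) = ENNReal.ofReal ((1/2) * Real.exp (-t)) := by
  rw [laplaceMeasure_apply measurableSet_Ioi, integral_const_mul, ← integral_exp_neg_Ioi]
  congr 2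
  refine setIntegral_congr_fun measurableSet_Ioi fun x hx => ?_
  simp only [abs_of_nonneg (ht.trans (mem_Ioi.1 hx).le)]

lemma laplaceMeasure_Iic_neg {t : ℝ} (ht : 0 ≤ t) :
    laplaceMeasure (Iic (-t)) = ENNReal.ofReal ((1/2) * Real.exp (-t)) := by
  rw [laplaceMeasure_apply measurableSet_Iic, integral_const_mul, ← integral_exp_Iic]
  congr 2
  refine setIntegral_congr_fun measurableSet_Iic fun x hx => ?_
  have : x ≤ 0 := (mem_Iic.1 hx).trans (by linarith)
  simp only [abs_of_nonpos this, neg_neg]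

instance isProbabilityMeasure_laplaceMeasure : IsProbabilityMeasure laplaceMeasure where
  measure_univ := by
    have h1 := laplaceMeasure_Iic_neg le_rfl
    rw [neg_zero] at h1
    rw [← Iic_union_Ioi (a := (0 : ℝ)), measure_union (Iic_disjoint_Ioi le_rfl) measurableSet_Ioi,
      h1, laplaceMeasure_Ioi le_rfl, ← ENNReal.ofReal_add (by positivity) (by positivity)]
    norm_num

lemma integrable_exp_mul_laplaceMeasure {s : ℝ} (hs : |s| < 1) :
    Integrable (fun x : ℝ => Real.exp (s * x)) laplaceMeasure := by
  rw [laplaceMeasure, integrable_withDensity_iff_integrable_smul' (by fun_prop)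
    (ae_of_all _ fun _ => ENNReal.ofReal_lt_top)]
  refine ((integrable_exp_neg_abs_mul_exp hs).const_mul (1/2)).congr (ae_of_all _ fun x => ?_)
  simp only [smul_eq_mul]
  rw [ENNReal.toReal_ofReal (by positivity)]
  ring

lemma integrable_exp_mul_sum_laplaceMeasure (L : ℕ) {s : ℝ} (hs : |s| < 1) :
    Integrable (fun x : Fin L → ℝ => Real.exp (s * ∑ i, x i))
      (Measure.pi fun _ : Fin L => laplaceMeasure) := by
  simp_rw [Finset.mul_sum, Real.exp_sum]
  exact Integrable.fintype_prod fun _ => integrable_exp_mul_laplaceMeasure hs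

lemma one_sub_DEL (L : ℕ) (t : ℝ) :
    1 - DEL L t = (Measure.pi fun _ : Fin L => laplaceMeasure).real {x | t < ∑ i, x i} := by
  have hm : MeasurableSet {x : Fin L → ℝ | ∑ i, x i ≤ t} :=
    measurableSet_le (by fun_prop) measurable_const
  have h := probReal_compl_eq_one_sub (μ := Measure.pi fun _ : Fin L => laplaceMeasure) hm
  rw [DEL, ← measureReal_def, ← h]
  congr 1
  ext x
  simp

lemma le_measureReal_pi_laplaceMeasure {L : ℕ} (hL : 1 ≤ L) {t : ℝ} {A : Set ℝ}
    (hA : laplaceMeasure A = ENNReal.ofReal ((1/2) * Real.exp (-(t / L)))) {B : Set (Fin L → ℝ)}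
    (hB : univ.pi (fun _ => A) ⊆ B) :
    (1/2) ^ L * Real.exp (-t) ≤ (Measure.pi fun _ : Fin L => laplaceMeasure).real B := by
  have hL0 : (L : ℝ) ≠ 0 := by positivity
  refine le_of_eq_of_le ?_ (measureReal_mono hB)
  rw [measureReal_def, Measure.pi_pi, Finset.prod_const, Finset.card_univ, Fintype.card_fin, hA,
    ENNReal.toReal_pow, ENNReal.toReal_ofReal (by positivity), mul_pow, ← Real.exp_nat_mul]
  congr 2
  field_simp

/-- The exponential tail rate of the `L`-fold Laplace convolution is the same as that of a
single standard Laplace distribution: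
`lim_{t→∞} (1/t) log (1 - DE_L(t)) = -1` and `lim_{t→∞} (1/t) log DE_L(-t) = -1`. -/
theorem laplace_convolution_tail_rate (L : ℕ) (hL : 1 ≤ L) :
    Tendsto (fun t : ℝ => (1/t) * Real.log (1 - DEL L t)) atTop (nhds (-1)) ∧
    Tendsto (fun t : ℝ => (1/t) * Real.log (DEL L (-t))) atTop (nhds (-1)) := by
  have hL0 : (0 : ℝ) < L := by exact_mod_cast hL
  have : Nonempty (Fin L) := ⟨⟨0, hL⟩⟩
  have habs : ∀ s : ℝ, 0 < s → s < 1 → |s| < 1 := fun s h0 h1 => by rwa [abs_of_pos h0]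
  constructor
  · refine tendsto_inv_mul_log_of_exp_bounds (c := (1/2) ^ L) (by positivity) (fun t ht => ?_)
      (fun s hs hs1 => ⟨ProbabilityTheory.mgf (fun x : Fin L → ℝ => ∑ i, x i)
        (Measure.pi fun _ => laplaceMeasure) s, fun t _ => ?_⟩)
    · rw [one_sub_DEL]
      refine le_measureReal_pi_laplaceMeasure hL (laplaceMeasure_Ioi (by positivity)) ?_
      intro x hx
      have h := Finset.sum_lt_sum_of_nonempty (Finset.univ_nonempty (α := Fin L))
        fun i _ => mem_Ioi.1 (hx i (mem_univ i))
      simpa [mul_div_cancel₀ t hL0.ne', mul_div_assoc', hL0.ne'] using h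
    · rw [one_sub_DEL]
      refine le_trans (measureReal_mono fun x hx => ?_)
        (ProbabilityTheory.measure_ge_le_exp_mul_mgf t hs.le
          (integrable_exp_mul_sum_laplaceMeasure L (habs s hs hs1)))
      exact le_of_lt hx.out
  · refine tendsto_inv_mul_log_of_exp_bounds (c := (1/2) ^ L) (by positivity) (fun t ht => ?_)
      (fun s hs hs1 => ⟨ProbabilityTheory.mgf (fun x : Fin L → ℝ => ∑ i, x i)
        (Measure.pi fun _ => laplaceMeasure) (-s), fun t _ => ?_⟩)
    · refine le_measureReal_pi_laplaceMeasure hL (laplaceMeasure_Iic_neg (by positivity)) ?_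
      intro x hx
      have h := Finset.sum_le_sum fun i (_ : i ∈ Finset.univ) => mem_Iic.1 (hx i (mem_univ i))
      simpa [mul_div_cancel₀ t hL0.ne', mul_div_assoc', hL0.ne'] using h
    · have h := ProbabilityTheory.measure_le_le_exp_mul_mgf (-t) (neg_nonpos.2 hs.le)
        (integrable_exp_mul_sum_laplaceMeasure L (s := -s) (by rw [abs_neg]; exact habs s hs hs1))
      rwa [neg_neg, ← neg_mul_comm] at h
end

section
/- Let θ_0 > 0 and n_1, n_2 ≥ 1 be integers, and let Y_1, Y_2 be independent random variables with P(Y_i ≤ t) = (t/θ_0)^{n_i} for 0 ≤ t ≤ θ_0 (the distribution of the maximum of n_i i.i.d. U[0, θ_0] observations). Define CD densities h_i(y) = n_i Y_i^{n_i} y^{−(n_i+1)} for y ≥ Y_i and h_i(y) = 0 otherwise, and set H_P(θ) = [∫_{−∞}^{θ} h_1(y) h_2(y) dy] / [∫_ℝ h_1(y) h_2(y) dy]. Let Y = max(Y_1, Y_2) and N = n_1 + n_2. Then: (i) for every θ ≥ Y, H_P(θ) = 1 − (Y/θ)^{N+1}; (ii) for every t ∈ [0,1], P(H_P(θ_0)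 ≤ t) = 1 − (1 − t)^{N/(N+1)}; in particular H_P(θ_0) is not uniformly distributed on [0,1] (so H_P is not an exact confidence distribution), but P(H_P(θ_0) ≤ t) → t for every t ∈ [0,1] as N → ∞ (so H_P is an asymptotic confidence distribution). -/
open MeasureTheory ProbabilityTheory Set Filter

/-- The CD density `hᵢ(y) = nᵢ Yᵢ^{nᵢ} y^{-(nᵢ+1)}` for `y ≥ Yᵢ` (and `0` otherwise) of the
confidence distribution `Hᵢ(θ) = 1 - (Yᵢ/θ)^{nᵢ}` in Example 4.1. -/
noncomputable def uniformScaleCDdens (n : ℕ) (Yval y : ℝ) : ℝ :=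
  if Yval ≤ y then (n : ℝ) * Yval ^ n / y ^ (n + 1) else 0

/-- The normalized product `H_P` of the two CD densities, as in equation (4.1). -/
noncomputable def uniformScaleHP (n₁ n₂ : ℕ) (y₁ y₂ θ : ℝ) : ℝ :=
  (∫ y in Iio θ, uniformScaleCDdens n₁ y₁ y * uniformScaleCDdens n₂ y₂ y) /
    (∫ y, uniformScaleCDdens n₁ y₁ y * uniformScaleCDdens n₂ y₂ y)

/-- On positive parameters the product of the two densities is a Pareto-type density supported on
`[max y₁ y₂, ∞)`. -/
lemma uniformScaleCDdens_mul_eq_indicator (n₁ n₂ : ℕ) {y₁ y₂ : ℝ} (hy₁ : 0 < y₁) :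
    (fun y => uniformScaleCDdens n₁ y₁ y * uniformScaleCDdens n₂ y₂ y) =
      (Ici (max y₁ y₂)).indicator
        (fun y => (n₁ * y₁ ^ n₁ * (n₂ * y₂ ^ n₂)) * y ^ (-((n₁ + n₂ + 2 : ℕ) : ℝ))) := by
  ext y
  by_cases h : max y₁ y₂ ≤ y
  · have h₁ : y₁ ≤ y := (le_max_left _ _).trans h
    have h₂ : y₂ ≤ y := (le_max_right _ _).trans h
    have hy : 0 < y := hy₁.trans_le h₁
    rw [indicator_of_mem (mem_Ici.2 h), Real.rpow_neg hy.le, Real.rpow_natCast]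
    simp only [uniformScaleCDdens, h₁, h₂, if_true]
    field_simp
    ring
  · rw [indicator_of_notMem (by simpa using h)]
    rcases not_and_or.1 (fun h' => h (max_le_iff.2 h')) with h' | h' <;>
      simp [uniformScaleCDdens, h']

lemma integrableOn_Ici_rpow_neg_add_two (k : ℕ) {a : ℝ} (ha : 0 < a) :
    IntegrableOn (fun y : ℝ => y ^ (-((k + 2 : ℕ) : ℝ))) (Ici a) := by
  rw [integrableOn_Ici_iff_integrableOn_Ioi]
  refine integrableOn_Ioi_rpow_of_lt ?_ ha
  push_cast
  linarith [(Nat.cast_nonneg k : (0 : ℝ) ≤ k)]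

lemma integral_Ici_rpow_neg_add_two (k : ℕ) {a : ℝ} (ha : 0 < a) :
    ∫ y in Ici a, y ^ (-((k + 2 : ℕ) : ℝ)) = (a ^ (k + 1))⁻¹ / (k + 1) := by
  have hk : (0 : ℝ) ≤ k := Nat.cast_nonneg k
  rw [integral_Ici_eq_integral_Ioi, integral_Ioi_rpow_of_lt (by push_cast; linarith) ha]
  have h : -((k + 2 : ℕ) : ℝ) + 1 = -((k + 1 : ℕ) : ℝ) := by push_cast; ring
  rw [h, Real.rpow_neg ha.le, Real.rpow_natCast, neg_div_neg_eq]
  push_cast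
  rfl

/-- Closed form of the normalized product of the two densities. -/
lemma uniformScaleHP_eq {n₁ n₂ : ℕ} (hn₁ : 1 ≤ n₁) (hn₂ : 1 ≤ n₂) {y₁ y₂ θ : ℝ}
    (hy₁ : 0 < y₁) (hy₂ : 0 < y₂) (hθ : max y₁ y₂ ≤ θ) :
    uniformScaleHP n₁ n₂ y₁ y₂ θ = 1 - (max y₁ y₂ / θ) ^ (n₁ + n₂ + 1) := by
  unfold uniformScaleHP
  rw [uniformScaleCDdens_mul_eq_indicator n₁ n₂ hy₁]
  have hm : 0 < max y₁ y₂ := hy₁.trans_le (le_max_left _ _)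
  have hθ' : 0 < θ := hm.trans_le hθ
  set m := max y₁ y₂
  set c : ℝ := n₁ * y₁ ^ n₁ * (n₂ * y₂ ^ n₂)
  have hn₁' : (0 : ℝ) < n₁ := by exact_mod_cast hn₁
  have hn₂' : (0 : ℝ) < n₂ := by exact_mod_cast hn₂
  have hc0 : 0 < c := by positivity
  set g : ℝ → ℝ := fun y => c * y ^ (-((n₁ + n₂ + 2 : ℕ) : ℝ)) with hg
  have hint : Integrable ((Ici m).indicator g) := by
    rw [integrable_indicator_iff measurableSet_Ici]
    exact (integrableOn_Ici_rpow_neg_add_two (n₁ + n₂) hm).const_mul c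
  have hval : ∀ a : ℝ, 0 < a →
      ∫ y in Ici a, g y = c * ((a ^ (n₁ + n₂ + 1))⁻¹ / ((n₁ + n₂ : ℕ) + 1)) := by
    intro a ha
    rw [hg, integral_const_mul, integral_Ici_rpow_neg_add_two (n₁ + n₂) ha]
  have htot : ∫ y, (Ici m).indicator g y = ∫ y in Ici m, g y :=
    integral_indicator measurableSet_Ici
  have htail : ∫ y in Ici θ, (Ici m).indicator g y = ∫ y in Ici θ, g y := by
    rw [setIntegral_indicator measurableSet_Ici,
      inter_eq_left.2 (Ici_subset_Ici.2 hθ)]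
  have hsplit := integral_add_compl (measurableSet_Iio (a := θ)) hint
  rw [compl_Iio, htail] at hsplit
  rw [eq_sub_of_add_eq hsplit, htot, hval m hm, hval θ hθ', div_pow]
  have hN : (0 : ℝ) < ((n₁ + n₂ : ℕ) : ℝ) + 1 := by positivity
  field_simp

/-- The law of a scaled power distribution has no atoms on its range. -/
lemma measure_lt_eq_of_measure_le_eq {Ω : Type*} [MeasurableSpace Ω] {P : Measure Ω}
    {θ₀ : ℝ} {n : ℕ} (hn : 1 ≤ n) {Y : Ω → ℝ}
    (hcdf : ∀ t ∈ Icc (0 : ℝ) θ₀, P {ω | Y ω ≤ t} = ENNReal.ofReal ((t / θ₀) ^ n))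
    {s : ℝ} (hs : s ∈ Icc (0 : ℝ) θ₀) :
    P {ω | Y ω < s} = ENNReal.ofReal ((s / θ₀) ^ n) := by
  apply le_antisymm
  · rw [← hcdf s hs]
    exact measure_mono fun ω (h : Y ω < s) => h.le
  rcases hs.1.eq_or_lt with rfl | hs0
  · simp [Nat.one_le_iff_ne_zero.1 hn]
  have hcont : Continuous fun r : ℝ => ENNReal.ofReal ((r / θ₀) ^ n) :=
    ENNReal.continuous_ofReal.comp (by fun_prop)
  refine le_of_tendsto (hcont.continuousAt.tendsto.mono_left
    (nhdsWithin_le_nhds (a := s) (s := Iio s))) ?_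
  filter_upwards [Ioo_mem_nhdsLT hs0] with r hr
  rw [← hcdf r ⟨hr.1.le, hr.2.le.trans hs.2⟩]
  exact measure_mono fun ω (h : Y ω ≤ r) => h.trans_lt hr.2

lemma ae_pos_and_le_of_measure_le_eq {Ω : Type*} [MeasurableSpace Ω] {P : Measure Ω}
    [IsProbabilityMeasure P] {θ₀ : ℝ} (hθ₀ : 0 < θ₀) {n : ℕ} (hn : 1 ≤ n) {Y : Ω → ℝ}
    (hm : Measurable Y)
    (hcdf : ∀ t ∈ Icc (0 : ℝ) θ₀, P {ω | Y ω ≤ t} = ENNReal.ofReal ((t / θ₀) ^ n)) :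
    ∀ᵐ ω ∂P, 0 < Y ω ∧ Y ω ≤ θ₀ := by
  have h0 : ∀ᵐ ω ∂P, 0 < Y ω := by
    rw [ae_iff]
    simpa [Nat.one_le_iff_ne_zero.1 hn] using hcdf 0 ⟨le_rfl, hθ₀.le⟩
  have h1 : ∀ᵐ ω ∂P, Y ω ≤ θ₀ := by
    refine (mem_ae_iff_prob_eq_one (measurableSet_le hm measurable_const)).2 ?_
    simpa [hθ₀.ne'] using hcdf θ₀ ⟨hθ₀.le, le_rfl⟩
  exact h0.and h1

/-- The law of the maximum of two independent scaled power variables. -/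
lemma measure_le_max_eq {Ω : Type*} [MeasurableSpace Ω] {P : Measure Ω}
    [IsProbabilityMeasure P] {θ₀ : ℝ} {n₁ n₂ : ℕ} (hn₁ : 1 ≤ n₁) (hn₂ : 1 ≤ n₂)
    {Y₁ Y₂ : Ω → ℝ} (hm₁ : Measurable Y₁) (hm₂ : Measurable Y₂) (hind : IndepFun Y₁ Y₂ P)
    (hcdf₁ : ∀ t ∈ Icc (0 : ℝ) θ₀, P {ω | Y₁ ω ≤ t} = ENNReal.ofReal ((t / θ₀) ^ n₁))
    (hcdf₂ : ∀ t ∈ Icc (0 : ℝ) θ₀, P {ω | Y₂ ω ≤ t} = ENNReal.ofReal ((t / θ₀) ^ n₂))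
    {s : ℝ} (hs : s ∈ Icc (0 : ℝ) θ₀) :
    P {ω | s ≤ max (Y₁ ω) (Y₂ ω)} = ENNReal.ofReal (1 - (s / θ₀) ^ (n₁ + n₂)) := by
  have hq : 0 ≤ s / θ₀ := div_nonneg hs.1 (hs.1.trans hs.2)
  have hlt : P {ω | max (Y₁ ω) (Y₂ ω) < s} = ENNReal.ofReal ((s / θ₀) ^ (n₁ + n₂)) := by
    have h := hind.measure_inter_preimage_eq_mul (Iio s) (Iio s) measurableSet_Iio
      measurableSet_Iio
    have h₁ := measure_lt_eq_of_measure_le_eq hn₁ hcdf₁ hs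
    have h₂ := measure_lt_eq_of_measure_le_eq hn₂ hcdf₂ hs
    have e : {ω | max (Y₁ ω) (Y₂ ω) < s} = Y₁ ⁻¹' Iio s ∩ Y₂ ⁻¹' Iio s := by
      ext ω
      simp
    rw [e, h, pow_add, ENNReal.ofReal_mul (by positivity), ← h₁, ← h₂]
    rfl
  have hc : {ω | s ≤ max (Y₁ ω) (Y₂ ω)} = {ω | max (Y₁ ω) (Y₂ ω) < s}ᶜ := by
    ext ω
    simp only [mem_ofPred_eq, mem_compl_iff, not_lt]
  rw [hc, prob_compl_eq_one_sub (measurableSet_lt (hm₁.max hm₂) measurable_const), hlt,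
    ENNReal.ofReal_sub _ (by positivity), ENNReal.ofReal_one]

lemma tendsto_one_sub_one_sub_rpow_div_add_one (t : ℝ) :
    Tendsto (fun N : ℕ => 1 - (1 - t) ^ ((N : ℝ) / ((N : ℝ) + 1))) atTop (nhds t) := by
  have hexp : Tendsto (fun N : ℕ => (N : ℝ) / ((N : ℝ) + 1)) atTop (nhds 1) :=
    tendsto_natCast_div_add_atTop 1
  have hpow := (tendsto_const_nhds (x := 1 - t)).rpow hexp (Or.inr one_pos)
  simpa using hpow.const_sub 1

/-- **Example 4.1.** For `U[0,θ₀]` maxima `Y₁, Y₂` of samples of sizes `n₁, n₂`, with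
`Y = max(Y₁,Y₂)` and `N = n₁ + n₂`:
(i) `H_P(θ) = 1 - (Y/θ)^{N+1}` for `θ ≥ Y`;
(ii) `P(H_P(θ₀) ≤ t) = 1 - (1-t)^{N/(N+1)}` for `t ∈ [0,1]`, so `H_P(θ₀)` is not uniform
on `[0,1]` and `H_P` is not an exact CD;
(iii) `1 - (1-t)^{N/(N+1)} → t` as `N → ∞`, so `H_P` is an asymptotic CD. -/
theorem uniform_scale_product_not_exact_but_asymptotic
    {Ω : Type*} [MeasurableSpace Ω] (P : Measure Ω) [IsProbabilityMeasure P]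
    (θ₀ : ℝ) (hθ₀ : 0 < θ₀) (n₁ n₂ : ℕ) (hn₁ : 1 ≤ n₁) (hn₂ : 1 ≤ n₂)
    (Y₁ Y₂ : Ω → ℝ) (hm₁ : Measurable Y₁) (hm₂ : Measurable Y₂)
    (hind : IndepFun Y₁ Y₂ P)
    (hcdf₁ : ∀ t ∈ Icc (0:ℝ) θ₀, P {ω | Y₁ ω ≤ t} = ENNReal.ofReal ((t / θ₀) ^ n₁))
    (hcdf₂ : ∀ t ∈ Icc (0:ℝ) θ₀, P {ω | Y₂ ω ≤ t} = ENNReal.ofReal ((t / θ₀) ^ n₂)) :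
    (∀ᵐ ω ∂P, ∀ θ : ℝ, max (Y₁ ω) (Y₂ ω) ≤ θ →
      uniformScaleHP n₁ n₂ (Y₁ ω) (Y₂ ω) θ
        = 1 - (max (Y₁ ω) (Y₂ ω) / θ) ^ (n₁ + n₂ + 1))
    ∧
    (∀ t ∈ Icc (0:ℝ) 1,
      P {ω | uniformScaleHP n₁ n₂ (Y₁ ω) (Y₂ ω) θ₀ ≤ t}
        = ENNReal.ofReal
            (1 - (1 - t) ^ (((n₁ + n₂ : ℕ) : ℝ) / (((n₁ + n₂ : ℕ) : ℝ) + 1))))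
    ∧
    (∀ t ∈ Icc (0:ℝ) 1,
      Tendsto (fun N : ℕ => 1 - (1 - t) ^ ((N : ℝ) / ((N : ℝ) + 1)))
        atTop (nhds t)) := by
  have hY₁ := ae_pos_and_le_of_measure_le_eq hθ₀ hn₁ hm₁ hcdf₁
  have hY₂ := ae_pos_and_le_of_measure_le_eq hθ₀ hn₂ hm₂ hcdf₂
  refine ⟨?_, ?_, fun t _ => tendsto_one_sub_one_sub_rpow_div_add_one t⟩
  · filter_upwards [hY₁, hY₂] with ω h₁ h₂ θ hθ
    exact uniformScaleHP_eq hn₁ hn₂ h₁.1 h₂.1 hθ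
  rintro t ⟨ht0, ht1⟩
  have hu0 : 0 ≤ 1 - t := sub_nonneg.2 ht1
  set N := n₁ + n₂
  set q : ℝ := (1 - t) ^ (((N + 1 : ℕ) : ℝ)⁻¹) with hq
  have hq0 : 0 ≤ q := Real.rpow_nonneg hu0 _
  have hq1 : q ≤ 1 := Real.rpow_le_one hu0 (by linarith) (by positivity)
  have hqN : q ^ (N + 1) = 1 - t := Real.rpow_inv_natCast_pow hu0 N.succ_ne_zero
  have hs : θ₀ * q ∈ Icc (0 : ℝ) θ₀ :=
    ⟨mul_nonneg hθ₀.le hq0, mul_le_of_le_one_right hθ₀.le hq1⟩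
  have hae : P {ω | uniformScaleHP n₁ n₂ (Y₁ ω) (Y₂ ω) θ₀ ≤ t}
      = P {ω | θ₀ * q ≤ max (Y₁ ω) (Y₂ ω)} := by
    apply measure_congr
    filter_upwards [hY₁, hY₂] with ω h₁ h₂
    refine propext (?_ : uniformScaleHP n₁ n₂ (Y₁ ω) (Y₂ ω) θ₀ ≤ t ↔
      θ₀ * q ≤ max (Y₁ ω) (Y₂ ω))
    have hM : 0 ≤ max (Y₁ ω) (Y₂ ω) / θ₀ :=
      div_nonneg (h₁.1.le.trans (le_max_left _ _)) hθ₀.le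
    rw [uniformScaleHP_eq hn₁ hn₂ h₁.1 h₂.1 (max_le h₁.2 h₂.2), sub_le_comm, ← hqN,
      pow_le_pow_iff_left₀ hq0 hM N.succ_ne_zero, le_div_iff₀ hθ₀, mul_comm]
  rw [hae, measure_le_max_eq hn₁ hn₂ hm₁ hm₂ hind hcdf₁ hcdf₂ hs,
    mul_div_cancel_left₀ _ hθ₀.ne', hq, ← Real.rpow_natCast, ← Real.rpow_mul hu0]
  congr 3
  rw [Nat.cast_succ, inv_mul_eq_div]
end

section
/- Let θ_0 ∈ ℝ, σ > 0, n ≥ 1 and z > 0. Let X̄_1 and X̄_2 be independent random variables, each Gaussian with mean θ_0 and variance σ²/n. Define the random intervals I_i = (X̄_i − z σ/√n, X̄_i + z σ/√n) for i = 1, 2. Then P(I_1 ∩ I_2 = ∅) = 2(1 − Φ(√2 · z)), where Φ is the standard normal CDF. -/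
open MeasureTheory ProbabilityTheory Set

/-- The standard normal density `φ(t) = (2π)^{-1/2} e^{-t²/2}`. -/
noncomputable def stdNormalPDF (t : ℝ) : ℝ :=
  (Real.sqrt (2 * Real.pi))⁻¹ * Real.exp (-t ^ 2 / 2)

/-- The standard normal CDF `Φ(x) = ∫_{-∞}^x φ(t) dt`. -/
noncomputable def stdNormalCDF (x : ℝ) : ℝ :=
  ∫ t in Iio x, stdNormalPDF t

lemma stdNormalPDF_eq_gaussianPDFReal : stdNormalPDF = gaussianPDFReal 0 1 := by
  ext t
  simp [stdNormalPDF, gaussianPDFReal]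

lemma stdNormalCDF_eq_gaussianReal_Iio (x : ℝ) :
    stdNormalCDF x = (gaussianReal 0 1).real (Iio x) := by
  rw [Measure.real, gaussianReal_apply_eq_integral 0 one_ne_zero, ENNReal.toReal_ofReal
    (integral_nonneg (gaussianPDFReal_nonneg 0 1)), stdNormalCDF, stdNormalPDF_eq_gaussianPDFReal]

lemma gaussianReal_real_Ici (x : ℝ) :
    (gaussianReal 0 1).real (Ici x) = 1 - stdNormalCDF x := by
  rw [stdNormalCDF_eq_gaussianReal_Iio, ← compl_Iio, probReal_compl_eq_one_sub measurableSet_Iio]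

lemma gaussianReal_real_Iic_neg (x : ℝ) :
    (gaussianReal 0 1).real (Iic (-x)) = 1 - stdNormalCDF x := by
  have hmap : (gaussianReal 0 1).map (fun t ↦ -t) = gaussianReal 0 1 := by
    rw [gaussianReal_map_neg, neg_zero]
  rw [← gaussianReal_real_Ici, ← hmap, map_measureReal_apply measurable_neg measurableSet_Iic,
    hmap]
  congr 1
  ext t
  simp

lemma gaussianReal_two_sided_tail {x : ℝ} (hx : 0 < x) :
    gaussianReal 0 1 {t | x ≤ |t|} = ENNReal.ofReal (2 * (1 - stdNormalCDF x)) := by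
  have hset : {t : ℝ | x ≤ |t|} = Ici x ∪ Iic (-x) := by
    ext t
    simp [le_abs, le_neg]
  have hdisj : Disjoint (Ici x) (Iic (-x)) := by
    rw [Set.disjoint_left]
    intro t ht ht'
    rw [mem_Ici] at ht
    rw [mem_Iic] at ht'
    linarith
  rw [hset, ← ofReal_measureReal, measureReal_union hdisj measurableSet_Iic,
    gaussianReal_real_Ici, gaussianReal_real_Iic_neg, two_mul]

lemma Ioo_sub_add_inter_eq_empty_iff {a b r : ℝ} (hr : 0 < r) :
    Ioo (a - r) (a + r) ∩ Ioo (b - r) (b + r) = ∅ ↔ 2 * r ≤ |a - b| := by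
  rw [← disjoint_iff_inter_eq_empty, Ioo_disjoint_Ioo, le_abs]
  grind

lemma hasLaw_standardized_sub {Ω : Type*} [MeasurableSpace Ω] {P : Measure Ω}
    {μ : ℝ} {v : NNReal} {X Y : Ω → ℝ} (hv : v ≠ 0) (hXY : IndepFun X Y P)
    (hX : HasLaw X (gaussianReal μ v) P) (hY : HasLaw Y (gaussianReal μ v) P) :
    HasLaw (fun ω ↦ (X ω - Y ω) / √(2 * v)) (gaussianReal 0 1) P := by
  have hsub : HasLaw (X + -Y) (gaussianReal (μ + -μ) (v + v)) P :=
    ⟨hX.aemeasurable.add hY.aemeasurable.neg,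
      gaussianReal_add_gaussianReal_of_indepFun (hXY.comp measurable_id measurable_neg)
        hX.map_eq (gaussianReal_neg hY).map_eq⟩
  have hvar : (v + v) / .mk (√(2 * v) ^ 2) (sq_nonneg _) = (1 : NNReal) := by
    ext
    have hv' : (v : ℝ) ≠ 0 := NNReal.coe_ne_zero.mpr hv
    push_cast
    rw [Real.sq_sqrt (by positivity)]
    field_simp
    ring
  have h := gaussianReal_div_const hsub √(2 * v)
  rw [hvar, add_neg_cancel, zero_div] at h
  simpa only [Pi.add_apply, Pi.neg_apply, ← sub_eq_add_neg] using h

/-- **Remark 3.1 computation.** If `X̄₁, X̄₂` are independent `N(θ₀, σ²/n)` random variables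
and `Iᵢ = (X̄ᵢ - zσ/√n, X̄ᵢ + zσ/√n)`, then `P(I₁ ∩ I₂ = ∅) = 2(1 - Φ(√2 z))`. -/
theorem disjoint_z_intervals_probability
    {Ω : Type*} [MeasurableSpace Ω] (P : Measure Ω) [IsProbabilityMeasure P]
    (θ₀ σ z : ℝ) (hσ : 0 < σ) (hz : 0 < z) (n : ℕ) (hn : 1 ≤ n)
    (X₁ X₂ : Ω → ℝ) (hm₁ : Measurable X₁) (hm₂ : Measurable X₂)
    (hind : IndepFun X₁ X₂ P)
    (hd₁ : Measure.map X₁ P = gaussianReal θ₀ (Real.toNNReal (σ ^ 2 / n)))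
    (hd₂ : Measure.map X₂ P = gaussianReal θ₀ (Real.toNNReal (σ ^ 2 / n))) :
    P {ω | Ioo (X₁ ω - z * σ / Real.sqrt n) (X₁ ω + z * σ / Real.sqrt n) ∩
            Ioo (X₂ ω - z * σ / Real.sqrt n) (X₂ ω + z * σ / Real.sqrt n) = ∅}
      = ENNReal.ofReal (2 * (1 - stdNormalCDF (Real.sqrt 2 * z))) := by
  have hn' : (0 : ℝ) < n := by exact_mod_cast hn
  have hvar : 0 < σ ^ 2 / n := by positivity
  have hr : 0 < z * σ / √n := by positivity
  have hlaw := hasLaw_standardized_sub (Real.toNNReal_pos.mpr hvar).ne' hind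
    ⟨hm₁.aemeasurable, hd₁⟩ ⟨hm₂.aemeasurable, hd₂⟩
  have hscale : √(2 * (σ ^ 2 / n)) = √2 * (σ / √n) := by
    rw [Real.sqrt_mul zero_le_two, Real.sqrt_div (sq_nonneg σ), Real.sqrt_sq hσ.le]
  have hs : 0 < √2 * (σ / √n) := by positivity
  rw [Real.coe_toNNReal _ hvar.le, hscale] at hlaw
  have hmeas : MeasurableSet {t : ℝ | √2 * z ≤ |t|} :=
    measurableSet_le measurable_const measurable_id.abs
  rw [← gaussianReal_two_sided_tail (by positivity : 0 < √2 * z), ← hlaw.map_eq,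
    Measure.map_apply_of_aemeasurable hlaw.aemeasurable hmeas]
  congr 1
  ext ω
  rw [mem_ofPred_eq, mem_preimage, mem_ofPred_eq, Ioo_sub_add_inter_eq_empty_iff hr, abs_div,
    abs_of_pos hs, le_div_iff₀ hs]
  have hthreshold : √2 * z * (√2 * (σ / √n)) = 2 * (z * σ / √n) := by
    rw [mul_mul_mul_comm, Real.mul_self_sqrt zero_le_two, mul_div_assoc]
  rw [hthreshold]
end

section
/- Let L ≥ 2 and let θ_{0,1} = θ_0, θ_{0,2}, …, θ_{0,L} be real numbers. For each n ≥ 1 and each j = 1, …, L, let I_{j,n} be a random nonempty interval in ℝ. Assume: (i) for every ε > 0 and every j, almost surely I_{j,n} ⊆ (θ_{0,j} − ε, θ_{0,j} + ε) for all sufficiently large n; and (ii) for each j with θ_{0,j} = θ_0, Σ_{n=1}^∞ P(I_{1,n} ∩ I_{j,n} = ∅) < ∞. Then almost surely, for all sufficiently large n and every j = 2, …, L: I_{1,n} ∩ I_{j,n} ≠ ∅ if θ_{0,j} = θ_0, and I_{1,n} ∩ I_{j,n} = ∅ if θ_{0,j} ≠ θ_0. Consequently, the adaptive weights ω_j* =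 1_{(I_{1,n} ∩ I_{j,n} ≠ ∅)} coincide with the target weights ω_j^{(0)} = 1_{(θ_{0,j} = θ_0)} for all large n, almost surely. -/
open MeasureTheory Set Filter Classical

/-- Two random sets that eventually concentrate around distinct points are eventually disjoint. -/
theorem ae_eventually_inter_eq_empty_of_shrinking
    {Ω : Type*} [MeasurableSpace Ω] {P : Measure Ω} {A B : ℕ → Ω → Set ℝ} {a b : ℝ} (hab : a ≠ b)
    (hA : ∀ ε : ℝ, 0 < ε → ∀ᵐ ω ∂P, ∀ᶠ n in atTop, A n ω ⊆ Ioo (a - ε) (a + ε))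
    (hB : ∀ ε : ℝ, 0 < ε → ∀ᵐ ω ∂P, ∀ᶠ n in atTop, B n ω ⊆ Ioo (b - ε) (b + ε)) :
    ∀ᵐ ω ∂P, ∀ᶠ n in atTop, A n ω ∩ B n ω = ∅ := by
  have hε : 0 < |a - b| / 2 := half_pos (abs_pos.mpr (sub_ne_zero.mpr hab))
  filter_upwards [hA _ hε, hB _ hε] with ω h₁ h₂
  filter_upwards [h₁, h₂] with n hn₁ hn₂
  refine eq_empty_of_forall_notMem fun x ⟨hxA, hxB⟩ => ?_
  obtain ⟨l₁, u₁⟩ := hn₁ hxA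
  obtain ⟨l₂, u₂⟩ := hn₂ hxB
  rcases abs_cases (a - b) with ⟨h, _⟩ | ⟨h, _⟩ <;> linarith

/-- **Theorem 3.3.** Let `I n j` be random nonempty intervals, with `I n j` lying inside
any `ε`-neighborhood of the corresponding true value `θ j` for all large `n` a.s., and with
`∑ₙ P(I n i₀ ∩ I n j = ∅) < ∞` for each "right" study `j` (those with `θ j = θ i₀`),
where `i₀ = ⟨0, _⟩` indexes the current study. Then a.s., for all large `n`,
`I n i₀ ∩ I n j ≠ ∅` whenever `θ j = θ i₀` and `I n i₀ ∩ I n j = ∅` whenever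
`θ j ≠ θ i₀`; consequently the adaptive weights `ωⱼ* = 1_{(I n i₀ ∩ I n j ≠ ∅)}` coincide
with the target weights `ωⱼ⁽⁰⁾ = 1_{(θ j = θ i₀)}`. -/
theorem adaptive_weights_eventually_correct
    {Ω : Type*} [MeasurableSpace Ω] (P : Measure Ω) [IsProbabilityMeasure P]
    (L : ℕ) (hL : 2 ≤ L) (θ : Fin L → ℝ)
    (I : ℕ → Fin L → Ω → Set ℝ)
    (hne : ∀ n j ω, (I n j ω).Nonempty)
    (hint : ∀ n j ω, (I n j ω).OrdConnected)
    (hshrink : ∀ ε : ℝ, 0 < ε → ∀ j, ∀ᵐ ω ∂P,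
      ∀ᶠ n in atTop, I n j ω ⊆ Ioo (θ j - ε) (θ j + ε))
    (hsum : ∀ j, θ j = θ ⟨0, by omega⟩ →
      (∑' n : ℕ, P {ω | I n ⟨0, by omega⟩ ω ∩ I n j ω = ∅}) < ⊤) :
    ∀ᵐ ω ∂P, ∀ᶠ n in atTop, ∀ j : Fin L,
      ((θ j = θ ⟨0, by omega⟩ → (I n ⟨0, by omega⟩ ω ∩ I n j ω).Nonempty) ∧
       (θ j ≠ θ ⟨0, by omega⟩ → I n ⟨0, by omega⟩ ω ∩ I n j ω = ∅)) ∧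
      ((if (I n ⟨0, by omega⟩ ω ∩ I n j ω).Nonempty then (1:ℝ) else 0)
        = (if θ j = θ ⟨0, by omega⟩ then (1:ℝ) else 0)) := by
  have key : ∀ᵐ ω ∂P, ∀ j : Fin L, ∀ᶠ n in atTop,
      (I n ⟨0, by omega⟩ ω ∩ I n j ω).Nonempty ↔ θ j = θ ⟨0, by omega⟩ := by
    refine ae_all_iff.mpr fun j => ?_
    by_cases h : θ j = θ ⟨0, by omega⟩
    · filter_upwards [ae_eventually_notMem (hsum j h).ne] with ω hω
      filter_upwards [hω] with n hn
      exact iff_of_true (nonempty_iff_ne_empty.mpr hn) h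
    · filter_upwards [ae_eventually_inter_eq_empty_of_shrinking (Ne.symm h)
        (fun ε hε => hshrink ε hε ⟨0, by omega⟩) (fun ε hε => hshrink ε hε j)] with ω hω
      filter_upwards [hω] with n hn
      exact iff_of_false (not_nonempty_iff_eq_empty.mpr hn) h
  filter_upwards [key] with ω hω
  filter_upwards [eventually_all.mpr hω] with n hn j
  refine ⟨⟨(hn j).mpr, fun h => not_nonempty_iff_eq_empty.mp fun h' => h ((hn j).mp h')⟩, ?_⟩
  simp only [hn j]
end
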